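/- Every polyhedron that is combinatorially equivalent to the Klee–Walkup polyhedron U_4 (i.e., whose face lattice is isomorphic to that of U_4) has circuit diameter at most 4. That is, the circuit diameter of U_4 is at most 4 independent of realization. -/

import Mathlib

open scoped BigOperators

/-- Data defining a polyhedron `{z ∈ ℝ^d : A z ≥ b}` with rational data.
Under the `IsProper` assumption below it is full-dimensional with an
irredundant description, hence `d`-dimensional with exactly `f` facets. -/
structure PolyData (d f : ℕ) where
  A : Matrix (Fin f) (Fin d) ℚ
  b : Fin f → ℚ

namespace PolyData

variable {d f : ℕ}

/-- The `i`-th row of `A` (outer normal of the `i`-th facet), as a real vector. -/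
def row (P : PolyData d f) (i : Fin f) : Fin d → ℝ := fun j => (P.A i j : ℝ)

/-- The `i`-th right-hand side, as a real number. -/
def rhs (P : PolyData d f) (i : Fin f) : ℝ := (P.b i : ℝ)

/-- Value of the `i`-th linear form at `z`. -/
def eval (P : PolyData d f) (i : Fin f) (z : Fin d → ℝ) : ℝ := ∑ j, P.row i j * z j

/-- The feasible set `{z : A z ≥ b}`. -/
def toSet (P : PolyData d f) : Set (Fin d → ℝ) := {z | ∀ i, P.rhs i ≤ P.eval i z}

/-- Indices of the constraints (facets) active (incident) at `z`. -/
def activeAt (P : PolyData d f) (z : Fin d → ℝ) : Set (Fin f) := {i | P.eval i z = P.rhs i}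

/-- The `i`-th facet, as a subset of the polyhedron. -/
def facet (P : PolyData d f) (i : Fin f) : Set (Fin d → ℝ) :=
  {z ∈ P.toSet | P.eval i z = P.rhs i}

/-- The standing assumption: the polyhedron is full-dimensional and the
description is irredundant, i.e. every inequality is facet-defining. -/
def IsProper (P : PolyData d f) : Prop :=
  (∃ z, ∀ i, P.rhs i < P.eval i z) ∧
  ∀ i, ∃ z ∈ P.toSet, P.eval i z = P.rhs i ∧ ∀ i', i' ≠ i → P.rhs i' < P.eval i' z

/-- A vertex: a feasible point whose active outer normals span `ℝ^d`. -/
def IsVertex (P : PolyData d f) (v : Fin d → ℝ) : Prop :=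
  v ∈ P.toSet ∧ Submodule.span ℝ (P.row '' P.activeAt v) = ⊤

/-- A circuit direction of `P`: a nonzero `g` such that `A g` is
support-minimal in `{A x : x ≠ 0}` (taken here up to scaling). -/
def IsCircuit (P : PolyData d f) (g : Fin d → ℝ) : Prop :=
  g ≠ 0 ∧ ∀ x : Fin d → ℝ, x ≠ 0 →
    {i | P.eval i x ≠ 0} ⊆ {i | P.eval i g ≠ 0} →
    {i | P.eval i x ≠ 0} = {i | P.eval i g ≠ 0}

/-- The set of circuits of `P`. -/
def circuits (P : PolyData d f) : Set (Fin d → ℝ) := {g | P.IsCircuit g}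

/-- A (maximal) circuit walk `y 0, …, y k` of length `k`. -/
def IsCircuitWalk (P : PolyData d f) {k : ℕ} (y : Fin (k+1) → Fin d → ℝ) : Prop :=
  (∀ i, y i ∈ P.toSet) ∧
  ∀ i : Fin k, ∃ g ∈ P.circuits, ∃ α : ℝ, 0 < α ∧
    y i.succ = y i.castSucc + α • g ∧
    ∀ β : ℝ, α < β → y i.castSucc + β • g ∉ P.toSet

/-- The circuit distance from `u` to `v`: minimum length of a circuit walk. -/
noncomputable def circuitDistance (P : PolyData d f) (u v : Fin d → ℝ) : ℕ∞ :=
  sInf {n : ℕ∞ | ∃ k : ℕ, n = (k : ℕ∞) ∧ ∃ y : Fin (k+1) → Fin d → ℝ,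
    P.IsCircuitWalk y ∧ y 0 = u ∧ y (Fin.last k) = v}

/-- The circuit diameter: maximum circuit distance between two vertices. -/
noncomputable def circuitDiameter (P : PolyData d f) : ℕ∞ :=
  ⨆ (u : Fin d → ℝ) (v : Fin d → ℝ) (_ : P.IsVertex u) (_ : P.IsVertex v),
    P.circuitDistance u v

/-- `u` and `v` are joined by an edge of `P`. -/
def IsEdge (P : PolyData d f) (u v : Fin d → ℝ) : Prop :=
  P.IsVertex u ∧ P.IsVertex v ∧ u ≠ v ∧
  segment ℝ u v = {z ∈ P.toSet | P.activeAt u ∩ P.activeAt v ⊆ P.activeAt z}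

/-- An edge walk along vertices of `P`. -/
def IsEdgeWalk (P : PolyData d f) {k : ℕ} (y : Fin (k+1) → Fin d → ℝ) : Prop :=
  ∀ i : Fin k, P.IsEdge (y i.castSucc) (y i.succ)

/-- Combinatorial (edge) distance between two vertices. -/
noncomputable def edgeDistance (P : PolyData d f) (u v : Fin d → ℝ) : ℕ∞ :=
  sInf {n : ℕ∞ | ∃ k : ℕ, n = (k : ℕ∞) ∧ ∃ y : Fin (k+1) → Fin d → ℝ,
    P.IsEdgeWalk y ∧ y 0 = u ∧ y (Fin.last k) = v}

/-- Combinatorial (edge) diameter. -/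
noncomputable def edgeDiameter (P : PolyData d f) : ℕ∞ :=
  ⨆ (u : Fin d → ℝ) (v : Fin d → ℝ) (_ : P.IsVertex u) (_ : P.IsVertex v),
    P.edgeDistance u v

end PolyData

/-- `Δ_E(f,d)`: maximum combinatorial diameter of a `d`-dimensional
polyhedron with `f` facets. -/
noncomputable def maxEdgeDiameter (f d : ℕ) : ℕ∞ :=
  ⨆ (P : PolyData d f) (_ : P.IsProper), P.edgeDiameter

/-- `Δ_C(f,d)`: maximum circuit diameter of a `d`-dimensional polyhedron
with `f` facets. -/
noncomputable def maxCircuitDiameter (f d : ℕ) : ℕ∞ :=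
  ⨆ (P : PolyData d f) (_ : P.IsProper), P.circuitDiameter

/-- `Δ_C^u(f,d)`: maximum circuit diameter of an unbounded `d`-dimensional
polyhedron with `f` facets. -/
noncomputable def maxUnboundedCircuitDiameter (f d : ℕ) : ℕ∞ :=
  ⨆ (P : PolyData d f) (_ : P.IsProper ∧ ¬ Bornology.IsBounded P.toSet),
    P.circuitDiameter

namespace PolyData

variable {d f : ℕ}

/-- A walk is simple if each step enters exactly one new facet. -/
def IsSimpleWalk (P : PolyData d f) {k : ℕ} (y : Fin (k+1) → Fin d → ℝ) : Prop :=
  ∀ i : Fin k, (P.activeAt (y i.succ) \ P.activeAt (y i.castSucc)).ncard = 1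

/-- `P` is `C`-simple: all circuit walks of length at most `Δ_E(f,d)` are simple. -/
def IsCSimple (P : PolyData d f) : Prop :=
  ∀ k : ℕ, (k : ℕ∞) ≤ maxEdgeDiameter f d →
    ∀ y : Fin (k+1) → Fin d → ℝ, P.IsCircuitWalk y → P.IsSimpleWalk y

/-- A non-revisiting walk: each step enters a facet containing no earlier
point of the walk. -/
def IsNonRevisiting (P : PolyData d f) {k : ℕ} (y : Fin (k+1) → Fin d → ℝ) : Prop :=
  ∀ i : Fin k, ∃ j : Fin f, j ∈ P.activeAt (y i.succ) ∧
    ∀ i' : Fin (k+1), i' ≤ i.castSucc → j ∉ P.activeAt (y i')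

/-- `P` is a simple polyhedron: every vertex lies on exactly `d` facets. -/
def IsSimplePoly (P : PolyData d f) : Prop :=
  ∀ v, P.IsVertex v → (P.activeAt v).ncard = d

end PolyData

/-- Append a last coordinate: `(z, t) ∈ ℝ^{d+1}`. -/
def snocVec {d : ℕ} (z : Fin d → ℝ) (t : ℝ) : Fin (d+1) → ℝ := Fin.snoc z t

namespace PolyData

variable {d f : ℕ}

/-- `W` is a wedge on `P` over the facet with index `i₀`:
`W = H^≤ ∩ (P × [0,∞))`, where the boundary hyperplane `H = {w : a·w = β}`
of the halfspace `H^≤` contains `P × {0}` on its feasible side, meets the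
interior of `P × [0,∞)`, and meets `P × {0}` exactly in the facet `i₀`. -/
def IsWedgeOver (W : PolyData (d+1) (f+1)) (P : PolyData d f) (i₀ : Fin f) : Prop :=
  ∃ (a : Fin (d+1) → ℝ) (β : ℝ),
    (∀ z ∈ P.toSet, ∑ j, a j * snocVec z 0 j ≤ β) ∧
    (∃ z, (∀ i, P.rhs i < P.eval i z) ∧ ∃ t : ℝ, 0 < t ∧ ∑ j, a j * snocVec z t j = β) ∧
    (∀ z ∈ P.toSet, (∑ j, a j * snocVec z 0 j = β ↔ z ∈ P.facet i₀)) ∧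
    W.toSet = {w | ∑ j, a j * w j ≤ β} ∩
      {w | ∃ z ∈ P.toSet, ∃ t : ℝ, 0 ≤ t ∧ w = snocVec z t}

/-- `P` is wedge-simple: it is `C`-simple and over every facet there is a
`C`-simple wedge. -/
def IsWedgeSimple (P : PolyData d f) : Prop :=
  P.IsCSimple ∧ ∀ i₀ : Fin f, ∃ W : PolyData (d+1) (f+1),
    W.IsProper ∧ W.IsWedgeOver P i₀ ∧ W.IsCSimple

end PolyData

/-- `k`-wedge-simplicity: `0`-wedge-simple means `C`-simple, and `P` is
`(k+1)`-wedge-simple if it is `C`-simple and over every facet there is a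
`k`-wedge-simple wedge.  In particular `1`-wedge-simple = wedge-simple. -/
def IsKWedgeSimpleAux : ℕ → (d f : ℕ) → PolyData d f → Prop
  | 0, _, _, P => P.IsCSimple
  | (k+1), d, f, P => P.IsCSimple ∧ ∀ i₀ : Fin f,
      ∃ W : PolyData (d+1) (f+1), W.IsProper ∧ W.IsWedgeOver P i₀ ∧
        IsKWedgeSimpleAux k (d+1) (f+1) W

def IsKWedgeSimple (k : ℕ) {d f : ℕ} (P : PolyData d f) : Prop :=
  IsKWedgeSimpleAux k d f P

namespace PolyData

variable {d : ℕ}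

/-- `(P, u, v)` is a Dantzig figure: a `d`-dimensional polyhedron with `2d`
facets, `d` of which are incident to the vertex `u` and the other `d` to the
vertex `v`. -/
def IsDantzigFigure (P : PolyData d (2*d)) (u v : Fin d → ℝ) : Prop :=
  P.IsVertex u ∧ P.IsVertex v ∧ Disjoint (P.activeAt u) (P.activeAt v) ∧
  P.activeAt u ∪ P.activeAt v = Set.univ ∧
  (P.activeAt u).ncard = d ∧ (P.activeAt v).ncard = d

end PolyData

/-- The (exposed) faces of a polyhedron, each obtained by turning a subset of
the inequalities into equations. -/
def PolyData.faces {d f : ℕ} (P : PolyData d f) : Set (Set (Fin d → ℝ)) :=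
  {F | ∃ S : Set (Fin f), F = {z ∈ P.toSet | S ⊆ P.activeAt z}}

/-- Combinatorial equivalence: an inclusion-preserving bijection between the
face lattices. -/
def CombEquiv {d f d' f' : ℕ} (P : PolyData d f) (Q : PolyData d' f') : Prop :=
  ∃ φ : Set (Fin d → ℝ) → Set (Fin d' → ℝ),
    Set.BijOn φ P.faces Q.faces ∧
    ∀ F ∈ P.faces, ∀ G ∈ P.faces, (F ⊆ G ↔ φ F ⊆ φ G)

/-- Two facets are adjacent if they share a ridge (a codimension-2 face). -/
def PolyData.AdjacentFacets {d f : ℕ} (P : PolyData d f) (i j : Fin f) : Prop :=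
  i ≠ j ∧ Module.finrank ℝ (affineSpan ℝ (P.facet i ∩ P.facet j)).direction = d - 2

/-- The Klee–Walkup polyhedron `U_4`. -/
def U4 : PolyData 4 8 where
  A := !![-6,-3,0,1; -3,-6,1,0; -35,-45,6,3; -45,-35,3,6;
          1,0,0,0; 0,1,0,0; 0,0,1,0; 0,0,0,1]
  b := ![-1,-1,-8,-8,0,0,0,0]

namespace PolyData

variable {d f : ℕ}

lemma eval_add (P : PolyData d f) (i : Fin f) (x y : Fin d → ℝ) :
    P.eval i (x + y) = P.eval i x + P.eval i y := by
  simp [eval, mul_add, Finset.sum_add_distrib]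

lemma eval_smul (P : PolyData d f) (i : Fin f) (c : ℝ) (x : Fin d → ℝ) :
    P.eval i (c • x) = c * P.eval i x := by
  simp only [eval, Pi.smul_apply, smul_eq_mul, Finset.mul_sum]
  exact Finset.sum_congr rfl fun _ _ => by ring

lemma eval_sub (P : PolyData d f) (i : Fin f) (x y : Fin d → ℝ) :
    P.eval i (x - y) = P.eval i x - P.eval i y := by
  simp [eval, mul_sub, Finset.sum_sub_distrib]

lemma eval_neg (P : PolyData d f) (i : Fin f) (x : Fin d → ℝ) :
    P.eval i (-x) = -P.eval i x := by
  simp [eval]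

/-- Vectors annihilated by a spanning family of rows vanish. -/
lemma eq_zero_of_span_eq_top (P : PolyData d f) {S : Set (Fin f)}
    (hS : Submodule.span ℝ (P.row '' S) = ⊤) {x : Fin d → ℝ}
    (hx : ∀ i ∈ S, P.eval i x = 0) : x = 0 := by
  have key : ∀ r ∈ Submodule.span ℝ (P.row '' S), r ⬝ᵥ x = 0 := by
    intro r hr
    induction hr using Submodule.span_induction with
    | mem r hr => obtain ⟨i, hi, rfl⟩ := hr; exact hx i hi
    | zero => simp
    | add r s _ _ hr hs => simp [add_dotProduct, hr, hs]
    | smul c r _ hr => simp [smul_dotProduct, hr]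
  exact dotProduct_self_eq_zero.1 (key x (hS ▸ Submodule.mem_top))

/-- If a family of rows does not span, some nonzero vector is annihilated by all of them. -/
lemma exists_eval_eq_zero_of_span_ne_top (P : PolyData d f) {S : Set (Fin f)}
    (hS : Submodule.span ℝ (P.row '' S) ≠ ⊤) :
    ∃ x : Fin d → ℝ, x ≠ 0 ∧ ∀ i ∈ S, P.eval i x = 0 := by
  obtain ⟨φ, hφ, hker⟩ := Submodule.exists_le_ker_of_lt_top _ hS.lt_top
  have hφ_apply (r : Fin d → ℝ) : φ r = ∑ j, r j * φ (Pi.single j 1) := by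
    conv_lhs => rw [← Finset.univ_sum_single r]
    rw [map_sum]
    refine Finset.sum_congr rfl fun j _ => ?_
    rw [← smul_eq_mul, ← map_smul, ← Pi.single_smul, smul_eq_mul, mul_one]
  refine ⟨fun j => φ (Pi.single j 1), fun h => hφ (LinearMap.ext fun r => ?_), fun i hi => ?_⟩
  · rw [hφ_apply]
    exact Finset.sum_eq_zero fun j _ => mul_eq_zero_of_right _ (congrFun h j)
  · rw [eval, ← hφ_apply]
    exact hker (Submodule.subset_span ⟨i, hi, rfl⟩)

/-- The face cut out by turning the inequalities in `S` into equations. -/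
def face (P : PolyData d f) (S : Set (Fin f)) : Set (Fin d → ℝ) :=
  {z ∈ P.toSet | S ⊆ P.activeAt z}

lemma face_mem_faces (P : PolyData d f) (S : Set (Fin f)) : P.face S ∈ P.faces := ⟨S, rfl⟩

lemma face_anti (P : PolyData d f) {S T : Set (Fin f)} (h : S ⊆ T) : P.face T ⊆ P.face S :=
  fun _ hz => ⟨hz.1, h.trans hz.2⟩

lemma face_empty (P : PolyData d f) : P.face ∅ = P.toSet := by simp [face]

lemma facet_eq_face (P : PolyData d f) (i : Fin f) : P.facet i = P.face {i} := by
  ext z; simp [facet, face, activeAt]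

lemma subset_face_iff (P : PolyData d f) {F : Set (Fin d → ℝ)} (hF : F ⊆ P.toSet)
    (S : Set (Fin f)) : F ⊆ P.face S ↔ ∀ i ∈ S, F ⊆ P.facet i :=
  ⟨fun h _ hi _ hz => ⟨hF hz, (h hz).2 hi⟩, fun h _ hz => ⟨hF hz, fun i hi => (h i hi hz).2⟩⟩

lemma subset_toSet_of_mem_faces (P : PolyData d f) {F : Set (Fin d → ℝ)} (hF : F ∈ P.faces) :
    F ⊆ P.toSet := by
  obtain ⟨S, rfl⟩ := hF
  exact fun _ hz => hz.1

lemma toSet_mem_faces (P : PolyData d f) : P.toSet ∈ P.faces := P.face_empty ▸ P.face_mem_faces ∅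

lemma facet_mem_faces (P : PolyData d f) (i : Fin f) : P.facet i ∈ P.faces :=
  P.facet_eq_face i ▸ P.face_mem_faces {i}

lemma IsProper.facet_ne_toSet {P : PolyData d f} (hP : P.IsProper) (i : Fin f) :
    P.facet i ≠ P.toSet := by
  obtain ⟨⟨z, hz⟩, -⟩ := hP
  intro h
  have : z ∈ P.facet i := h ▸ fun j => (hz j).le
  exact (hz i).ne' this.2

lemma IsProper.eq_of_facet_subset_facet {P : PolyData d f} (hP : P.IsProper) {i j : Fin f}
    (h : P.facet i ⊆ P.facet j) : i = j := by
  obtain ⟨z, hz, hzi, hlt⟩ := hP.2 i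
  by_contra hne
  exact (hlt j (Ne.symm hne)).ne' (h ⟨hz, hzi⟩).2

lemma exists_subset_facet (P : PolyData d f) {F : Set (Fin d → ℝ)} (hF : F ∈ P.faces)
    (hne : F ≠ P.toSet) : ∃ i, F ⊆ P.facet i := by
  obtain ⟨S, rfl⟩ := hF
  obtain rfl | ⟨i, hi⟩ := S.eq_empty_or_nonempty
  · simp at hne
  · exact ⟨i, fun z hz => ⟨hz.1, hz.2 hi⟩⟩

/-- A vertex is the only point of its minimal face. -/
lemma IsVertex.face_activeAt {P : PolyData d f} {a : Fin d → ℝ} (ha : P.IsVertex a) :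
    P.face (P.activeAt a) = {a} := by
  refine Set.Subset.antisymm (fun z hz => ?_) (by simpa [face] using ha.1)
  refine sub_eq_zero.1 (P.eq_zero_of_span_eq_top ha.2 fun i hi => ?_)
  rw [eval_sub, show P.eval i z = P.rhs i from hz.2 hi, show P.eval i a = P.rhs i from hi, sub_self]

/-- Ratio test: moving along `g` until some decreasing constraint becomes active. -/
lemma exists_ratio_test (P : PolyData d f) {z g : Fin d → ℝ} (hz : z ∈ P.toSet)
    (hg : ∃ i, P.eval i g < 0) :
    ∃ t : ℝ, 0 ≤ t ∧ z + t • g ∈ P.toSet ∧ ∃ j, P.eval j g < 0 ∧ j ∈ P.activeAt (z + t • g) := by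
  classical
  obtain ⟨i, hi⟩ := hg
  obtain ⟨j, hj, hmin⟩ := (Finset.univ.filter fun i => P.eval i g < 0).exists_min_image
    (fun i => (P.eval i z - P.rhs i) / -P.eval i g) ⟨i, by simpa using hi⟩
  simp only [Finset.mem_filter, Finset.mem_univ, true_and] at hj hmin
  have ht : 0 ≤ (P.eval j z - P.rhs j) / -P.eval j g :=
    div_nonneg (sub_nonneg.2 (hz j)) (by linarith)
  refine ⟨_, ht, fun k => ?_, j, hj, ?_⟩
  · rw [eval_add, eval_smul]
    by_cases hk : P.eval k g < 0
    · have := (le_div_iff₀ (by linarith)).1 (hmin k hk)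
      linarith
    · have := mul_nonneg ht (not_lt.1 hk)
      linarith [hz k]
  · have hj' : -P.eval j g ≠ 0 := by linarith
    have := div_mul_cancel₀ (P.eval j z - P.rhs j) hj'
    change P.eval j (_ + _) = _
    rw [eval_add, eval_smul]
    linarith

/-- Every nonempty face of a pointed polyhedron contains a vertex. -/
lemma exists_isVertex_mem_face (P : PolyData d f) {v : Fin d → ℝ} (hv : P.IsVertex v)
    {S : Set (Fin f)} (hS : (P.face S).Nonempty) : ∃ a, P.IsVertex a ∧ a ∈ P.face S := by
  obtain ⟨z, hz, hmax⟩ := Set.Finite.exists_maximalFor' P.activeAt (P.face S) (Set.toFinite _) hS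
  refine ⟨z, ⟨hz.1, ?_⟩, hz⟩
  by_contra hspan
  obtain ⟨g, hg0, hg⟩ := P.exists_eval_eq_zero_of_span_ne_top hspan
  suffices key : ∀ g : Fin d → ℝ, (∀ i ∈ P.activeAt z, P.eval i g = 0) → ∀ i, 0 ≤ P.eval i g by
    refine hg0 (P.eq_zero_of_span_eq_top hv.2 fun i _ => (key g hg i).antisymm' ?_)
    have := key (-g) (fun i hi => by rw [eval_neg, hg i hi, neg_zero]) i
    rwa [eval_neg, neg_nonneg] at this
  intro g hg i
  by_contra! hi
  obtain ⟨t, -, hmem, j, hj, hjact⟩ := P.exists_ratio_test hz.1 ⟨i, hi⟩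
  have hsub : P.activeAt z ⊆ P.activeAt (z + t • g) := fun k hk => by
    change P.eval k (z + t • g) = _
    rw [eval_add, eval_smul, hg k hk, mul_zero, add_zero]
    exact hk
  exact hj.ne (hg j (hmax ⟨hmem, hz.2.trans hsub⟩ hsub hjact))

/-- A single maximal circuit step from `y` to `y'`. -/
def IsCircuitStep (P : PolyData d f) (y y' : Fin d → ℝ) : Prop :=
  y ∈ P.toSet ∧ y' ∈ P.toSet ∧ ∃ g ∈ P.circuits, ∃ α : ℝ, 0 < α ∧ y' = y + α • g ∧
    ∀ β : ℝ, α < β → y + β • g ∉ P.toSet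

/-- Moving within the intersection of all but one of a spanning family of hyperplanes until some
constraint becomes active is a circuit step. -/
lemma isCircuitStep_of_eval_eq (P : PolyData d f) {y y' : Fin d → ℝ} (hy : y ∈ P.toSet)
    (hy' : y' ∈ P.toSet) {T : Set (Fin f)} (hT : Submodule.span ℝ (P.row '' T) = ⊤) (k : Fin f)
    (hk : ∀ i ∈ T, i ≠ k → P.eval i y = P.eval i y') {j : Fin f} (hj : j ∉ P.activeAt y)
    (hj' : j ∈ P.activeAt y') : P.IsCircuitStep y y' := by
  have hjlt : P.rhs j < P.eval j y := lt_of_le_of_ne (hy j) (Ne.symm hj)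
  have hjeq : P.eval j y' = P.rhs j := hj'
  set g := y' - y with hg
  have hjg : P.eval j g < 0 := by rw [hg, eval_sub]; linarith
  have hzero : ∀ i ∈ T, i ≠ k → P.eval i g = 0 := fun i hi hik => by
    rw [hg, eval_sub, hk i hi hik, sub_self]
  have hg0 : g ≠ 0 := fun h => by simp [h, eval] at hjg
  have hkg : P.eval k g ≠ 0 := fun h => hg0 <| P.eq_zero_of_span_eq_top hT fun i hi => by
    by_cases hik : i = k
    · exact hik ▸ h
    · exact hzero i hi hik
  refine ⟨hy, hy', g, ⟨hg0, fun x hx hsub => ?_⟩, 1, one_pos, by simp [hg], fun β hβ hmem => ?_⟩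
  · set c := P.eval k x / P.eval k g with hc
    have hxg : x = c • g := by
      refine sub_eq_zero.1 (P.eq_zero_of_span_eq_top hT fun i hi => ?_)
      rw [eval_sub, eval_smul]
      by_cases hik : i = k
      · rw [hik, hc, div_mul_cancel₀ _ hkg, sub_self]
      · have hix : P.eval i x = 0 := by
          by_contra h
          exact hsub h (hzero i hi hik)
        rw [hix, hzero i hi hik, mul_zero, sub_zero]
    have hc0 : c ≠ 0 := fun h => hx (by rw [hxg, h, zero_smul])
    ext i
    rw [Set.mem_ofPred_eq, hxg, eval_smul]
    simp [hc0]
  · have h1 := hmem j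
    have h2 : P.eval j g = P.eval j y' - P.eval j y := by rw [hg, eval_sub]
    rw [eval_add, eval_smul] at h1
    nlinarith

/-- Some circuit walk of length at most `n` leads from `u` to `v`. -/
def Reaches (P : PolyData d f) (n : ℕ) (u v : Fin d → ℝ) : Prop :=
  ∃ k ≤ n, ∃ y : Fin (k + 1) → Fin d → ℝ, P.IsCircuitWalk y ∧ y 0 = u ∧ y (Fin.last k) = v

lemma reaches_refl (P : PolyData d f) (n : ℕ) {u : Fin d → ℝ} (hu : u ∈ P.toSet) :
    P.Reaches n u u :=
  ⟨0, n.zero_le, fun _ => u, ⟨fun _ => hu, fun i => i.elim0⟩, rfl, rfl⟩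

lemma IsCircuitStep.reaches {P : PolyData d f} {n : ℕ} {u v w : Fin d → ℝ}
    (h : P.IsCircuitStep u v) (hr : P.Reaches n v w) : P.Reaches (n + 1) u w := by
  obtain ⟨k, hk, y, ⟨hmem, hstep⟩, rfl, rfl⟩ := hr
  refine ⟨k + 1, by lia, Fin.cons u y, ⟨?_, ?_⟩, rfl, ?_⟩
  · exact Fin.cases h.1 hmem
  · refine Fin.cases ?_ fun i => ?_
    · simpa using h.2.2
    · simpa [← Fin.succ_castSucc] using hstep i
  · rw [← Fin.succ_last, Fin.cons_succ]

lemma Reaches.circuitDistance_le {P : PolyData d f} {n : ℕ} {u v : Fin d → ℝ}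
    (h : P.Reaches n u v) : P.circuitDistance u v ≤ n := by
  obtain ⟨k, hk, y, hy⟩ := h
  have hkn : (k : ℕ∞) ≤ n := by exact_mod_cast hk
  refine le_trans (sInf_le ?_) hkn
  exact ⟨k, rfl, y, hy⟩

end PolyData

/-- A combinatorial equivalence of proper polyhedra is induced by a bijection between their facets,
which preserves and reflects inclusion of faces. -/
lemma CombEquiv.exists_facet_equiv {d f d' f' : ℕ} {Q : PolyData d' f'} {P : PolyData d f}
    (h : CombEquiv Q P) (hQ : Q.IsProper) (hP : P.IsProper) :
    ∃ e : Fin f ≃ Fin f', ∀ S T : Set (Fin f),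
      Q.face (e '' S) ⊆ Q.face (e '' T) ↔ P.face S ⊆ P.face T := by
  obtain ⟨φ, hφ, hle⟩ := h
  have hsurj {F} (hF : F ∈ P.faces) : ∃ G ∈ Q.faces, φ G = F := hφ.surjOn hF
  have htop : φ Q.toSet = P.toSet := by
    obtain ⟨G, hG, hGP⟩ := hsurj P.toSet_mem_faces
    refine (P.subset_toSet_of_mem_faces (hφ.mapsTo Q.toSet_mem_faces)).antisymm ?_
    rw [← hGP, ← hle G hG _ Q.toSet_mem_faces]
    exact Q.subset_toSet_of_mem_faces hG
  have hne {F} (hF : F ∈ Q.faces) : φ F = P.toSet ↔ F = Q.toSet := by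
    rw [← htop]
    exact hφ.injOn.eq_iff hF Q.toSet_mem_faces
  have hfacet (i : Fin f) : ∃ i', φ (Q.facet i') = P.facet i := by
    obtain ⟨G, hG, hGi⟩ := hsurj (P.facet_mem_faces i)
    have hGne : G ≠ Q.toSet := fun h => hP.facet_ne_toSet i (hGi ▸ (hne hG).2 h)
    obtain ⟨i', hi'⟩ := Q.exists_subset_facet hG hGne
    obtain ⟨j, hj⟩ := P.exists_subset_facet (hφ.mapsTo (Q.facet_mem_faces i'))
      (fun h => hQ.facet_ne_toSet i' ((hne (Q.facet_mem_faces i')).1 h))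
    have hsub := (hle G hG _ (Q.facet_mem_faces i')).1 hi'
    rw [hGi] at hsub
    obtain rfl := hP.eq_of_facet_subset_facet (hsub.trans hj)
    exact ⟨i', hj.antisymm hsub⟩
  choose e he using hfacet
  have hinj : Function.Injective e := fun i j hij =>
    hP.eq_of_facet_subset_facet (by rw [← he i, ← he j, hij])
  have hsurj_e : Function.Surjective e := fun i' => by
    have hmem := Q.facet_mem_faces i'
    obtain ⟨j, hj⟩ := P.exists_subset_facet (hφ.mapsTo hmem)
      (fun h => hQ.facet_ne_toSet i' ((hne hmem).1 h))
    rw [← he j, ← hle _ hmem _ (Q.facet_mem_faces _)] at hj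
    exact ⟨j, (hQ.eq_of_facet_subset_facet hj).symm⟩
  have hface (S : Set (Fin f)) : φ (Q.face (e '' S)) = P.face S := by
    have hmem := Q.face_mem_faces (e '' S)
    refine Set.Subset.antisymm ?_ ?_
    · rw [P.subset_face_iff (P.subset_toSet_of_mem_faces (hφ.mapsTo hmem))]
      intro i hi
      rw [← he i, ← hle _ hmem _ (Q.facet_mem_faces _), Q.facet_eq_face]
      exact Q.face_anti (Set.singleton_subset_iff.2 ⟨i, hi, rfl⟩)
    · obtain ⟨G, hG, hGS⟩ := hsurj (P.face_mem_faces S)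
      rw [← hGS, ← hle G hG _ hmem, Q.subset_face_iff (Q.subset_toSet_of_mem_faces hG)]
      rintro _ ⟨i, hi, rfl⟩
      rw [hle G hG _ (Q.facet_mem_faces _), he i, hGS, P.facet_eq_face]
      exact P.face_anti (Set.singleton_subset_iff.2 hi)
  refine ⟨Equiv.ofBijective e ⟨hinj, hsurj_e⟩, fun S T => ?_⟩
  rw [← hface S, ← hface T]
  exact hle _ (Q.face_mem_faces _) _ (Q.face_mem_faces _)

namespace KleeWalkup

/-- The vertices of `U_4`, as sets of incident facets. -/
def vertexSets : List (Finset (Fin 8)) :=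
  [{0, 1, 2, 3}, {0, 2, 3, 4}, {0, 3, 4, 7}, {0, 3, 5, 6}, {0, 3, 6, 7}, {0, 5, 6, 7},
    {1, 2, 3, 5}, {1, 2, 4, 7}, {1, 2, 5, 6}, {1, 2, 6, 7}, {1, 4, 6, 7}, {2, 3, 4, 7},
    {2, 3, 5, 6}, {2, 3, 6, 7}, {4, 5, 6, 7}]

/-- The inclusion-minimal sets of facets of `U_4` with empty intersection. -/
def nonfaces : List (Finset (Fin 8)) :=
  [{0, 1, 4}, {0, 1, 5}, {0, 1, 6}, {0, 1, 7}, {0, 2, 5}, {0, 2, 6}, {0, 2, 7}, {0, 4, 5},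
    {0, 4, 6}, {1, 3, 4}, {1, 3, 6}, {1, 3, 7}, {1, 4, 5}, {1, 5, 7}, {2, 4, 5}, {2, 4, 6},
    {2, 5, 7}, {3, 4, 5}, {3, 4, 6}, {3, 5, 7}]

lemma mem_vertexSets_of_card (S : Finset (Fin 8)) (hcard : 4 ≤ S.card)
    (hS : ∀ N ∈ nonfaces, ¬ N ⊆ S) : S ∈ vertexSets := by
  revert S
  decide +kernel

lemma eq_of_subset {S T : Finset (Fin 8)} (hS : S ∈ vertexSets) (hT : T ∈ vertexSets)
    (h : S ⊆ T) : S = T := by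
  have key : ∀ S ∈ vertexSets, ∀ T ∈ vertexSets, S ⊆ T → S = T := by decide +kernel
  exact key S hS T hT h

/-- `adjacentWithin n S T`: the vertices `S` and `T` are joined by at most `n` edges. -/
def adjacentWithin : ℕ → Finset (Fin 8) → Finset (Fin 8) → Bool
  | 0, S, T => S = T
  | n + 1, S, T => S = T ∨ ∃ R ∈ vertexSets, (S ∩ R).card = 3 ∧ adjacentWithin n R T

lemma adjacentWithin_four : ∀ S ∈ vertexSets, ∀ T ∈ vertexSets,
    adjacentWithin 4 S T ∨ S = {4, 5, 6, 7} ∧ T = {0, 1, 2, 3} ∨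
      S = {0, 1, 2, 3} ∧ T = {4, 5, 6, 7} := by
  decide +kernel

/-- The slacks of the eight inequalities of `U_4`. -/
def slack (z : Fin 4 → ℝ) : Fin 8 → ℝ :=
  ![-6 * z 0 - 3 * z 1 + z 3 + 1, -3 * z 0 - 6 * z 1 + z 2 + 1,
    -35 * z 0 - 45 * z 1 + 6 * z 2 + 3 * z 3 + 8, -45 * z 0 - 35 * z 1 + 3 * z 2 + 6 * z 3 + 8,
    z 0, z 1, z 2, z 3]

lemma slack_eq (z : Fin 4 → ℝ) (i : Fin 8) : slack z i = U4.eval i z - U4.rhs i := by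
  fin_cases i <;>
    simp [slack, PolyData.eval, PolyData.rhs, PolyData.row, U4, Fin.sum_univ_succ] <;> ring

lemma mem_face_iff (z : Fin 4 → ℝ) (S : Set (Fin 8)) :
    z ∈ U4.face S ↔ (∀ i, 0 ≤ slack z i) ∧ ∀ i ∈ S, slack z i = 0 := by
  simp only [slack_eq, sub_nonneg, sub_eq_zero]
  rfl

lemma face_eq_empty_of_mem_nonfaces {N : Finset (Fin 8)} (hN : N ∈ nonfaces) :
    U4.face (N : Set (Fin 8)) = ∅ := by
  refine Set.eq_empty_of_forall_notMem fun z hz => ?_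
  obtain ⟨hz, hzN⟩ := (mem_face_iff z _).1 hz
  simp only [slack, Fin.forall_fin_succ, Fin.isValue, Matrix.cons_val] at hz
  obtain ⟨h0, h1, h2, h3, h4, h5, h6, h7, -⟩ := hz
  simp only [nonfaces, List.mem_cons, List.not_mem_nil, or_false] at hN
  rcases hN with rfl | rfl | rfl | rfl | rfl | rfl | rfl | rfl | rfl | rfl | rfl | rfl | rfl | rfl |
    rfl | rfl | rfl | rfl | rfl | rfl <;>
  · simp [slack] at hzN
    simp at h0 h1 h2 h3 h4 h5 h6 h7
    linarith

lemma face_nonempty_of_mem_vertexSets {T : Finset (Fin 8)} (hT : T ∈ vertexSets) :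
    (U4.face (T : Set (Fin 8))).Nonempty := by
  suffices ∃ z : Fin 4 → ℝ, (∀ i, 0 ≤ slack z i) ∧ ∀ i ∈ T, slack z i = 0 by
    simpa [Set.Nonempty, mem_face_iff] using this
  simp only [vertexSets, List.mem_cons, List.not_mem_nil, or_false] at hT
  rcases hT with rfl | rfl | rfl | rfl | rfl | rfl | rfl | rfl | rfl | rfl | rfl | rfl | rfl | rfl |
    rfl
  · exact ⟨![1, 1, 8, 8], by simp [slack, Fin.forall_fin_succ]; norm_num⟩
  · exact ⟨![0, 1 / 2, 13 / 6, 1 / 2], by simp [slack, Fin.forall_fin_succ]; norm_num⟩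
  · exact ⟨![0, 1 / 3, 11 / 9, 0], by simp [slack, Fin.forall_fin_succ]; norm_num⟩
  · exact ⟨![2 / 9, 0, 0, 1 / 3], by simp [slack, Fin.forall_fin_succ]; norm_num⟩
  · exact ⟨![11 / 75, 1 / 25, 0, 0], by simp [slack, Fin.forall_fin_succ]; norm_num⟩
  · exact ⟨![1 / 6, 0, 0, 0], by simp [slack, Fin.forall_fin_succ]; norm_num⟩
  · exact ⟨![1 / 2, 0, 1 / 2, 13 / 6], by simp [slack, Fin.forall_fin_succ]; norm_num⟩
  · exact ⟨![0, 2 / 9, 1 / 3, 0], by simp [slack, Fin.forall_fin_succ]; norm_num⟩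
  · exact ⟨![1 / 3, 0, 0, 11 / 9], by simp [slack, Fin.forall_fin_succ]; norm_num⟩
  · exact ⟨![1 / 25, 11 / 75, 0, 0], by simp [slack, Fin.forall_fin_succ]; norm_num⟩
  · exact ⟨![0, 1 / 6, 0, 0], by simp [slack, Fin.forall_fin_succ]; norm_num⟩
  · exact ⟨![0, 8 / 25, 16 / 15, 0], by simp [slack, Fin.forall_fin_succ]; norm_num⟩
  · exact ⟨![8 / 25, 0, 0, 16 / 15], by simp [slack, Fin.forall_fin_succ]; norm_num⟩
  · exact ⟨![1 / 10, 1 / 10, 0, 0], by simp [slack, Fin.forall_fin_succ]; norm_num⟩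
  · exact ⟨![0, 0, 0, 0], by simp [slack, Fin.forall_fin_succ]⟩

/-- The edge of `U_4` leaving the vertex `{0, 1, 2, 3}` along facets `0, 1, 3` is not degenerate. -/
lemma not_face_subset_face_apex :
    ¬ U4.face (({0, 1, 2, 3} : Finset (Fin 8)).erase 2 : Set (Fin 8)) ⊆
      U4.face (({0, 1, 2, 3} : Finset (Fin 8)) : Set (Fin 8)) := by
  have key : (![2, 1, 11, 14] : Fin 4 → ℝ) ∈
      U4.face (({0, 1, 2, 3} : Finset (Fin 8)).erase 2 : Set (Fin 8)) := by
    rw [mem_face_iff]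
    simp [slack, Fin.forall_fin_succ]
    norm_num
  intro h
  have := ((mem_face_iff _ _).1 (h key)).2 2 (by simp)
  simp [slack] at this
  norm_num at this

/-- The edge of `U_4` leaving the origin along facets `4, 5, 7` is not degenerate. -/
lemma not_face_subset_face_origin :
    ¬ U4.face (({4, 5, 6, 7} : Finset (Fin 8)).erase 6 : Set (Fin 8)) ⊆
      U4.face (({4, 5, 6, 7} : Finset (Fin 8)) : Set (Fin 8)) := by
  have key : (![0, 0, 1, 0] : Fin 4 → ℝ) ∈
      U4.face (({4, 5, 6, 7} : Finset (Fin 8)).erase 6 : Set (Fin 8)) := by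
    rw [mem_face_iff]
    simp [slack, Fin.forall_fin_succ]
    norm_num
  intro h
  have := ((mem_face_iff _ _).1 (h key)).2 6 (by simp)
  simp [slack] at this

lemma isProper_U4 : U4.IsProper := by
  suffices (∃ z, ∀ i, 0 < slack z i) ∧
      ∀ i, ∃ z, slack z i = 0 ∧ ∀ j, j ≠ i → 0 < slack z j by
    simp only [slack_eq, sub_pos, sub_eq_zero] at this
    refine ⟨this.1, fun i => ?_⟩
    obtain ⟨z, hz, hlt⟩ := this.2 i
    refine ⟨z, fun j => ?_, hz, hlt⟩
    obtain rfl | hj := eq_or_ne j i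
    exacts [hz.ge, (hlt j hj).le]
  refine ⟨⟨![1 / 10, 1 / 10, 1, 1], by simp [slack, Fin.forall_fin_succ]; norm_num⟩, fun i => ?_⟩
  fin_cases i
  · exact ⟨![1 / 4, 1 / 4, 2, 5 / 4], by simp [slack, Fin.forall_fin_succ]; norm_num⟩
  · exact ⟨![1 / 4, 1 / 4, 5 / 4, 2], by simp [slack, Fin.forall_fin_succ]; norm_num⟩
  · exact ⟨![1 / 5, 1 / 5, 17 / 20, 29 / 30], by simp [slack, Fin.forall_fin_succ]; norm_num⟩
  · exact ⟨![1 / 5, 1 / 5, 29 / 30, 17 / 20], by simp [slack, Fin.forall_fin_succ]; norm_num⟩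
  · exact ⟨![0, 1 / 10, 1, 1], by simp [slack, Fin.forall_fin_succ]; norm_num⟩
  · exact ⟨![1 / 10, 0, 1, 1], by simp [slack, Fin.forall_fin_succ]; norm_num⟩
  · exact ⟨![1 / 10, 1 / 10, 0, 1], by simp [slack, Fin.forall_fin_succ]; norm_num⟩
  · exact ⟨![1 / 10, 1 / 10, 1, 0], by simp [slack, Fin.forall_fin_succ]; norm_num⟩

lemma exists_activeAt_eq {x : Fin 4 → ℝ} (hx : U4.IsVertex x) :
    ∃ T ∈ vertexSets, U4.activeAt x = T := by
  classical
  refine ⟨(U4.activeAt x).toFinset, mem_vertexSets_of_card _ ?_ fun N hN hsub => ?_, by simp⟩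
  · have h := finrank_span_finset_le_card (R := ℝ) ((U4.activeAt x).toFinset.image U4.row)
    rw [Finset.coe_image, Set.coe_toFinset, Set.finrank, hx.2, finrank_top,
      Module.finrank_fin_fun] at h
    exact h.trans Finset.card_image_le
  · have : x ∈ U4.face (N : Set (Fin 8)) := ⟨hx.1, fun i hi => by simpa using hsub hi⟩
    rwa [face_eq_empty_of_mem_nonfaces hN] at this

lemma isVertex_zero : U4.IsVertex 0 := by
  refine ⟨((mem_face_iff 0 ∅).2 (by simp [slack, Fin.forall_fin_succ])).1, ?_⟩
  by_contra hspan
  obtain ⟨x, hx, hzero⟩ := U4.exists_eval_eq_zero_of_span_ne_top hspan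
  have hact (i : Fin 8) (hi : slack 0 i = 0) : i ∈ U4.activeAt 0 := by
    rwa [slack_eq, sub_eq_zero] at hi
  have h4 := hzero 4 (hact 4 (by simp [slack]))
  have h5 := hzero 5 (hact 5 (by simp [slack]))
  have h6 := hzero 6 (hact 6 (by simp [slack]))
  have h7 := hzero 7 (hact 7 (by simp [slack]))
  refine hx (funext fun j => ?_)
  simp [PolyData.eval, PolyData.row, U4, Fin.sum_univ_succ] at h4 h5 h6 h7
  fin_cases j <;> assumption

/-- `Q` has the faces of `U_4`, with facets labelled by `e`, at least one vertex, and no point on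
all facets. -/
structure IsRealization {d' f' : ℕ} (Q : PolyData d' f') (e : Fin 8 ≃ Fin f') : Prop where
  face_subset_iff : ∀ S T : Set (Fin 8), Q.face (e '' S) ⊆ Q.face (e '' T) ↔
    U4.face S ⊆ U4.face T
  face_univ : Q.face Set.univ = ∅
  exists_isVertex : ∃ v, Q.IsVertex v

namespace IsRealization

variable {d' f' : ℕ} {Q : PolyData d' f'} {e : Fin 8 ≃ Fin f'}

lemma face_eq_empty_iff (h : IsRealization Q e) (S : Set (Fin 8)) :
    Q.face (e '' S) = ∅ ↔ U4.face S = ∅ := by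
  have hU : U4.face Set.univ = ∅ := by
    rw [← Set.subset_empty_iff,
      ← face_eq_empty_of_mem_nonfaces (N := {0, 1, 4}) (by simp [nonfaces])]
    exact U4.face_anti (Set.subset_univ _)
  have := h.face_subset_iff S Set.univ
  rwa [hU, Set.image_univ, e.range_eq_univ, h.face_univ, Set.subset_empty_iff,
    Set.subset_empty_iff] at this

lemma face_nonempty_iff (h : IsRealization Q e) (S : Set (Fin 8)) :
    (Q.face (e '' S)).Nonempty ↔ (U4.face S).Nonempty := by
  rw [Set.nonempty_iff_ne_empty, Set.nonempty_iff_ne_empty, Ne, h.face_eq_empty_iff]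

/-- The facets at a vertex of `Q` correspond to the facets at a vertex of `U_4`. -/
lemma exists_activeAt_eq (h : IsRealization Q e) {a : Fin d' → ℝ} (ha : Q.IsVertex a) :
    ∃ T ∈ vertexSets, Q.activeAt a = e '' T := by
  obtain ⟨S, hS⟩ : ∃ S : Set (Fin 8), Q.activeAt a = e '' S :=
    ⟨e ⁻¹' Q.activeAt a, (e.image_preimage _).symm⟩
  have hface : Q.face (e '' S) = {a} := hS ▸ ha.face_activeAt
  obtain ⟨x, hx, hxS⟩ := U4.exists_isVertex_mem_face isVertex_zero
    ((h.face_nonempty_iff S).1 (hface ▸ Set.singleton_nonempty a))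
  have hsub : Q.face (e '' U4.activeAt x) ⊆ {a} := hface ▸ Q.face_anti (Set.image_mono hxS.2)
  obtain ⟨b, hb⟩ := (h.face_nonempty_iff (U4.activeAt x)).2 ⟨x, hx.1, subset_rfl⟩
  obtain rfl : b = a := hsub hb
  obtain ⟨T, hT, hTx⟩ := KleeWalkup.exists_activeAt_eq hx
  refine ⟨T, hT, Set.Subset.antisymm ?_ (hTx ▸ hb.2)⟩
  rw [hS, ← hTx]
  exact Set.image_mono hxS.2

lemma exists_isVertex_activeAt_eq (h : IsRealization Q e) {T : Finset (Fin 8)}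
    (hT : T ∈ vertexSets) : ∃ a, Q.IsVertex a ∧ Q.activeAt a = e '' T := by
  obtain ⟨v, hv⟩ := h.exists_isVertex
  obtain ⟨a, ha, haT⟩ := Q.exists_isVertex_mem_face hv
    ((h.face_nonempty_iff T).2 (face_nonempty_of_mem_vertexSets hT))
  obtain ⟨R, hR, haR⟩ := h.exists_activeAt_eq ha
  have hTR : T ⊆ R := by
    have := haT.2
    rwa [haR, Set.image_subset_image_iff e.injective, Finset.coe_subset] at this
  exact ⟨a, ha, eq_of_subset hT hR hTR ▸ haR⟩

lemma eq_of_activeAt_eq {a b : Fin d' → ℝ} (ha : Q.IsVertex a) (hb : Q.IsVertex b)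
    (hab : Q.activeAt a = Q.activeAt b) : a = b := by
  rw [← Set.singleton_eq_singleton_iff, ← ha.face_activeAt, hab, hb.face_activeAt]

/-- Moving along an edge between two vertices of `Q` is a circuit step. -/
lemma isCircuitStep_of_card_inter {a b : Fin d' → ℝ}
    {S T : Finset (Fin 8)} (ha : Q.IsVertex a) (hb : Q.IsVertex b) (haS : Q.activeAt a = e '' S)
    (hbT : Q.activeAt b = e '' T) (hS : S.card = 4) (hT : T.card = 4) (hST : (S ∩ T).card = 3) :
    Q.IsCircuitStep a b := by
  obtain ⟨k, hk⟩ : ∃ k, S \ T = {k} := Finset.card_eq_one.1 (by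
    have := Finset.card_sdiff_add_card_inter S T
    lia)
  obtain ⟨j, hj⟩ : ∃ j, j ∈ T \ S := Finset.card_pos.1 (by
    have := Finset.card_sdiff_add_card_inter T S
    rw [Finset.inter_comm] at this
    lia)
  rw [Finset.mem_sdiff] at hj
  refine Q.isCircuitStep_of_eval_eq ha.1 hb.1 ha.2 (e k) ?_ (j := e j) ?_ ?_
  · intro i hi hik
    have hi' := hi
    rw [haS] at hi'
    obtain ⟨m, hm, rfl⟩ := hi'
    have hmT : m ∈ T := by
      by_contra hmT
      have : m ∈ S \ T := Finset.mem_sdiff.2 ⟨hm, hmT⟩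
      rw [hk, Finset.mem_singleton] at this
      exact hik (this ▸ rfl)
    have hmb : e m ∈ Q.activeAt b := hbT ▸ ⟨m, hmT, rfl⟩
    exact Eq.trans hi (Eq.symm hmb)
  · rw [haS, e.injective.mem_set_image]
    exact hj.2
  · rw [hbT]
    exact ⟨j, hj.1, rfl⟩

lemma card_of_mem_vertexSets {T : Finset (Fin 8)} (hT : T ∈ vertexSets) : T.card = 4 := by
  have key : ∀ T ∈ vertexSets, T.card = 4 := by decide +kernel
  exact key T hT

lemma reaches_of_adjacentWithin (h : IsRealization Q e) {n : ℕ} {a b : Fin d' → ℝ}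
    {S T : Finset (Fin 8)} (ha : Q.IsVertex a) (hb : Q.IsVertex b) (haS : Q.activeAt a = e '' S)
    (hbT : Q.activeAt b = e '' T) (hS : S ∈ vertexSets) (hST : adjacentWithin n S T) :
    Q.Reaches n a b := by
  have hrefl (h : S = T) : Q.Reaches n a b := by
    obtain rfl := eq_of_activeAt_eq ha hb (by rw [haS, hbT, h])
    exact Q.reaches_refl n ha.1
  induction n generalizing a S with
  | zero => exact hrefl (by simpa [adjacentWithin] using hST)
  | succ n ih =>
    simp only [adjacentWithin, decide_eq_true_eq] at hST
    obtain hST | ⟨R, hR, hcard, hRT⟩ := hST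
    · exact hrefl hST
    · obtain ⟨c, hc, hcR⟩ := h.exists_isVertex_activeAt_eq hR
      refine (isCircuitStep_of_card_inter ha hc haS hcR (card_of_mem_vertexSets hS)
        (card_of_mem_vertexSets hR) hcard).reaches (ih hc hcR hR hRT fun h => ?_)
      obtain rfl := eq_of_activeAt_eq hc hb (by rw [hcR, hbT, h])
      exact Q.reaches_refl n hc.1

/-- If the edge leaving the vertex `T` when facet `l` is dropped is unbounded, then the slack of
`l` takes every positive value on it. -/
lemma exists_mem_ray (h : IsRealization Q e) {b : Fin d' → ℝ} (hb : Q.IsVertex b)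
    {T : Finset (Fin 8)} (hbT : Q.activeAt b = e '' T) {l : Fin 8}
    (hne : ¬ U4.face (T.erase l : Set (Fin 8)) ⊆ U4.face (T : Set (Fin 8)))
    (hray : ∀ m ∉ T, ∃ N ∈ nonfaces, N ⊆ insert m (T.erase l)) {c : ℝ} (hc : Q.rhs (e l) < c) :
    ∃ q ∈ Q.face (e '' (T.erase l : Set (Fin 8))), Q.eval (e l) q = c := by
  rw [← h.face_subset_iff, Set.not_subset] at hne
  obtain ⟨z, hz, hzT⟩ := hne
  have hbact {m : Fin 8} (hm : m ∈ T) : Q.eval (e m) b = Q.rhs (e m) := by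
    have : e m ∈ Q.activeAt b := hbT ▸ ⟨m, hm, rfl⟩
    exact this
  have hzact {m : Fin 8} (hm : m ∈ T.erase l) : Q.eval (e m) z = Q.rhs (e m) :=
    hz.2 ⟨m, hm, rfl⟩
  have hlT : l ∈ T := by
    by_contra hl
    rw [Finset.erase_eq_of_notMem hl] at hz
    exact hzT hz
  have hzl : Q.rhs (e l) < Q.eval (e l) z := by
    refine lt_of_le_of_ne (hz.1 _) fun hl => hzT ⟨hz.1, ?_⟩
    rintro _ ⟨m, hm, rfl⟩
    obtain rfl | hml := eq_or_ne m l
    exacts [hl.symm, hzact (Finset.mem_erase.2 ⟨hml, hm⟩)]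
  have hgl : 0 < Q.eval (e l) (z - b) := by
    rw [Q.eval_sub, hbact hlT]
    linarith
  have hgzero {m : Fin 8} (hm : m ∈ T.erase l) : Q.eval (e m) (z - b) = 0 := by
    rw [Q.eval_sub, hzact hm, hbact (Finset.mem_of_mem_erase hm), sub_self]
  have hact (t : ℝ) {m : Fin 8} (hm : m ∈ T.erase l) : e m ∈ Q.activeAt (b + t • (z - b)) := by
    change Q.eval _ _ = _
    rw [Q.eval_add, Q.eval_smul, hgzero hm, hbact (Finset.mem_of_mem_erase hm), mul_zero, add_zero]
  have hnonneg (i : Fin f') : 0 ≤ Q.eval i (z - b) := by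
    by_contra! hi
    obtain ⟨t, -, hmem, j, hj, hjact⟩ := Q.exists_ratio_test hb.1 ⟨i, hi⟩
    obtain ⟨m, rfl⟩ := e.surjective j
    have hmT : m ∉ T := fun hm => by
      obtain rfl | hml := eq_or_ne m l
      · exact hj.not_gt hgl
      · exact hj.ne (hgzero (Finset.mem_erase.2 ⟨hml, hm⟩))
    obtain ⟨N, hN, hNsub⟩ := hray m hmT
    have hempty := (h.face_eq_empty_iff N).2 (face_eq_empty_of_mem_nonfaces hN)
    have hface : b + t • (z - b) ∈ Q.face (e '' (N : Set (Fin 8))) := by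
      refine ⟨hmem, ?_⟩
      rintro _ ⟨i, hi, rfl⟩
      obtain rfl | hi := Finset.mem_insert.1 (hNsub hi)
      exacts [hjact, hact t hi]
    rwa [hempty] at hface
  set t := (c - Q.rhs (e l)) / Q.eval (e l) (z - b) with ht
  have ht0 : 0 ≤ t := div_nonneg (by linarith) hgl.le
  refine ⟨b + t • (z - b), ⟨fun i => ?_, ?_⟩, ?_⟩
  · rw [Q.eval_add, Q.eval_smul]
    linarith [hb.1 i, mul_nonneg ht0 (hnonneg i)]
  · rintro _ ⟨m, hm, rfl⟩
    exact hact t hm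
  · rw [Q.eval_add, Q.eval_smul, ht, div_mul_cancel₀ _ hgl.ne', hbact hlT]
    ring

/-- A point on the two-dimensional face `T \ {k, l}`, off the facets `k` and `l`, is two circuit
steps away from the vertex `T` if that face contains an unbounded edge `T \ {l}`: move parallel to
facet `l` until hitting this edge, and follow it to the vertex. -/
lemma reaches_two_of_ray (h : IsRealization Q e) {w b : Fin d' → ℝ} (hw : w ∈ Q.toSet)
    (hb : Q.IsVertex b) {R T : Finset (Fin 8)} (hwR : Q.activeAt w = e '' R)
    (hbT : Q.activeAt b = e '' T) {k l : Fin 8} (hkl : k ≠ l) (hkT : k ∈ T) (hlT : l ∈ T)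
    (hkR : k ∉ R) (hlR : l ∉ R) (hTR : ∀ m ∈ T, m ≠ k → m ≠ l → m ∈ R)
    (hne : ¬ U4.face (T.erase l : Set (Fin 8)) ⊆ U4.face (T : Set (Fin 8)))
    (hray : ∀ m ∉ T, ∃ N ∈ nonfaces, N ⊆ insert m (T.erase l)) : Q.Reaches 2 w b := by
  have hw_notMem {m : Fin 8} (hm : m ∉ R) : e m ∉ Q.activeAt w := by
    rwa [hwR, e.injective.mem_set_image]
  have hlw : Q.rhs (e l) < Q.eval (e l) w := lt_of_le_of_ne (hw _) (Ne.symm (hw_notMem hlR))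
  obtain ⟨q, hq, hql⟩ := h.exists_mem_ray hb hbT hne hray hlw
  have hqact {m : Fin 8} (hm : m ∈ T) (hml : m ≠ l) : e m ∈ Q.activeAt q :=
    hq.2 ⟨m, Finset.mem_erase.2 ⟨hml, hm⟩, rfl⟩
  refine PolyData.IsCircuitStep.reaches (v := q) ?_
    (PolyData.IsCircuitStep.reaches (v := b) ?_ (Q.reaches_refl 0 hb.1))
  · refine Q.isCircuitStep_of_eval_eq hw hq.1 hb.2 (e k) ?_ (hw_notMem hkR) (hqact hkT hkl)
    rw [hbT]
    rintro _ ⟨m, hm, rfl⟩ hmk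
    obtain rfl | hml := eq_or_ne m l
    · exact hql.symm
    · have : e m ∈ Q.activeAt w := hwR ▸ ⟨m, hTR m hm (fun hmk' => hmk (hmk' ▸ rfl)) hml, rfl⟩
      exact Eq.trans this (Eq.symm (hqact hm hml))
  · refine Q.isCircuitStep_of_eval_eq hq.1 hb.1 hb.2 (e l) ?_ (j := e l) ?_ ?_
    · intro i hi hil
      have hi' := hi
      rw [hbT] at hi'
      obtain ⟨m, hm, rfl⟩ := hi'
      exact Eq.trans (hqact hm fun hml => hil (hml ▸ rfl)) (Eq.symm hi)
    · exact fun hl => hlw.ne' (hql.symm.trans hl)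
    · rw [hbT]
      exact ⟨l, hlT, rfl⟩

lemma reaches_apex (h : IsRealization Q e) {a b : Fin d' → ℝ} (ha : Q.IsVertex a)
    (hb : Q.IsVertex b) (haS : Q.activeAt a = e '' (({4, 5, 6, 7} : Finset (Fin 8)) : Set (Fin 8)))
    (hbT : Q.activeAt b = e '' (({0, 1, 2, 3} : Finset (Fin 8)) : Set (Fin 8))) :
    Q.Reaches 4 a b := by
  obtain ⟨c, hc, hcR⟩ := h.exists_isVertex_activeAt_eq (T := {0, 5, 6, 7}) (by decide)
  obtain ⟨w, hw, hwR⟩ := h.exists_isVertex_activeAt_eq (T := {0, 3, 5, 6}) (by decide)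
  refine (isCircuitStep_of_card_inter ha hc haS hcR rfl rfl (by decide)).reaches
    ((isCircuitStep_of_card_inter hc hw hcR hwR rfl rfl (by decide)).reaches ?_)
  exact h.reaches_two_of_ray hw.1 hb hwR hbT (k := 1) (l := 2) (by decide) (by decide) (by decide)
    (by decide) (by decide) (by decide) not_face_subset_face_apex (by decide)

lemma reaches_origin (h : IsRealization Q e) {a b : Fin d' → ℝ} (ha : Q.IsVertex a)
    (hb : Q.IsVertex b) (haS : Q.activeAt a = e '' (({0, 1, 2, 3} : Finset (Fin 8)) : Set (Fin 8)))
    (hbT : Q.activeAt b = e '' (({4, 5, 6, 7} : Finset (Fin 8)) : Set (Fin 8))) :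
    Q.Reaches 4 a b := by
  obtain ⟨c, hc, hcR⟩ := h.exists_isVertex_activeAt_eq (T := {0, 2, 3, 4}) (by decide)
  obtain ⟨w, hw, hwR⟩ := h.exists_isVertex_activeAt_eq (T := {0, 3, 4, 7}) (by decide)
  refine (isCircuitStep_of_card_inter ha hc haS hcR rfl rfl (by decide)).reaches
    ((isCircuitStep_of_card_inter hc hw hcR hwR rfl rfl (by decide)).reaches ?_)
  exact h.reaches_two_of_ray hw.1 hb hwR hbT (k := 5) (l := 6) (by decide) (by decide) (by decide)
    (by decide) (by decide) (by decide) not_face_subset_face_origin (by decide)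

lemma reaches_four (h : IsRealization Q e) {a b : Fin d' → ℝ} (ha : Q.IsVertex a)
    (hb : Q.IsVertex b) : Q.Reaches 4 a b := by
  obtain ⟨S, hS, haS⟩ := h.exists_activeAt_eq ha
  obtain ⟨T, hT, hbT⟩ := h.exists_activeAt_eq hb
  obtain hST | ⟨rfl, rfl⟩ | ⟨rfl, rfl⟩ := adjacentWithin_four S hS T hT
  exacts [h.reaches_of_adjacentWithin ha hb haS hbT hS hST, h.reaches_apex ha hb haS hbT,
    h.reaches_origin ha hb haS hbT]

end IsRealization

end KleeWalkup

/-- Theorem 15: every polyhedron combinatorially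
equivalent to the Klee–Walkup polyhedron `U_4` has circuit diameter at most
`4`, i.e. the circuit diameter of `U_4` is at most `4` independent of
realization. -/
theorem U4_circuitDiameter_le_four_any_realization {d' f' : ℕ}
    (Q : PolyData d' f') (hQ : Q.IsProper) (h : CombEquiv Q U4) :
    Q.circuitDiameter ≤ 4 := by
  refine iSup_le fun u => iSup_le fun v => iSup_le fun hu => iSup_le fun hv => ?_
  obtain rfl | huv := eq_or_ne u v
  · exact (Q.reaches_refl 4 hu.1).circuitDistance_le
  obtain ⟨e, he⟩ := h.exists_facet_equiv hQ KleeWalkup.isProper_U4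
  refine PolyData.Reaches.circuitDistance_le
    (KleeWalkup.IsRealization.reaches_four ⟨he, ?_, u, hu⟩ hu hv)
  refine Set.eq_empty_of_forall_notMem fun z hz => huv ?_
  have key {a} (ha : Q.IsVertex a) : z = a := by
    have : z ∈ Q.face (Q.activeAt a) := Q.face_anti (Set.subset_univ _) hz
    rwa [ha.face_activeAt] at this
  rw [← key hu, ← key hv]
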